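/- Lemma 5: Suppose Assumption 2 and Assumption 3 hold and 1/(2n) < h ≤ 1/n. Then for every s ∈ ℕ, no edge of G(H(0)) is lost in G(H(s)): for all i, j ∈ V, |y_i(0) − y_j(0)| < d implies |y_i(s) − y_j(s)| < d. -/

import Mathlib

open Matrix Filter Finset

/-- `Nb y d i` is the set of agents within confidence distance `d` of agent `i`. -/
noncomputable def Nb {n : ℕ} (y : Fin n → ℝ) (d : ℝ) (i : Fin n) : Finset (Fin n) :=
  Finset.univ.filter fun l => |y i - y l| < d

/-- One bounded-confidence averaging step: `x i = y i + h ∑_{l ∈ N_i} (y l - y i)`. -/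
noncomputable def bcStep {n : ℕ} (y : Fin n → ℝ) (d h : ℝ) (i : Fin n) : ℝ :=
  y i + h * ∑ l ∈ Nb y d i, (y l - y i)

/-- Bounded-confidence issue-sequence opinions: `x(0) = x0` and
`x(s+1) i = y(s) i + h ∑_{j ∈ N_i(s)} (y(s) j - y(s) i)` with `y(s) = Ψ x(s)`. -/
noncomputable def bcX {n : ℕ} (Ψ : Matrix (Fin n) (Fin n) ℝ) (h d : ℝ)
    (x0 : Fin n → ℝ) : ℕ → Fin n → ℝ
  | 0 => x0
  | s + 1 => bcStep (Ψ.mulVec (bcX Ψ h d x0 s)) d h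

/-- Ultimate opinions for issue `s`: `y(s) = Ψ x(s)`. -/
noncomputable def bcY {n : ℕ} (Ψ : Matrix (Fin n) (Fin n) ℝ) (h d : ℝ)
    (x0 : Fin n → ℝ) (s : ℕ) : Fin n → ℝ :=
  Ψ.mulVec (bcX Ψ h d x0 s)

/-- `S` is an independent strongly connected component of the influence graph `G(W)`. -/
def IsISCC {n : ℕ} (W : Matrix (Fin n) (Fin n) ℝ) (S : Set (Fin n)) : Prop :=
  S.Nonempty ∧ (∀ i ∈ S, ∀ j, W i j ≠ 0 → j ∈ S) ∧
    (∀ i ∈ S, ∀ j ∈ S, i ≠ j → ∃ m, 1 ≤ m ∧ 0 < (W ^ m) i j)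

/-- Assumption 2: every ISCC of `G(W)` contains at least one stubborn agent. -/
def Assumption2 {n : ℕ} (W : Matrix (Fin n) (Fin n) ℝ) (ξ : Fin n → ℝ) : Prop :=
  ∀ S : Set (Fin n), IsISCC W S → ∃ i ∈ S, ξ i < 1

/-- Every nonempty in-closed set of agents contains an ISCC. -/
theorem exists_isISCC_subset {n : ℕ} {W : Matrix (Fin n) (Fin n) ℝ}
    (hW0 : ∀ i j, 0 ≤ W i j) (hW1 : ∀ i, ∑ j, W i j = 1) {S : Set (Fin n)}
    (hS : S.Nonempty) (hSc : ∀ i ∈ S, ∀ j, W i j ≠ 0 → j ∈ S) :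
    ∃ T ⊆ S, IsISCC W T := by
  obtain ⟨T, hTS, ⟨hTn, hTc⟩, hmin⟩ := exists_minimal_le_of_wellFoundedLT
    (fun T : Set (Fin n) => T.Nonempty ∧ ∀ i ∈ T, ∀ j, W i j ≠ 0 → j ∈ T) S ⟨hS, hSc⟩
  have hpow : ∀ m i j, 0 ≤ (W ^ m) i j := by
    intro m
    induction m with
    | zero => intro i j; rw [pow_zero, Matrix.one_apply]; split_ifs <;> norm_num
    | succ m ih =>
      intro i j
      rw [pow_succ, Matrix.mul_apply]
      exact Finset.sum_nonneg fun k _ => mul_nonneg (ih i k) (hW0 k j)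
  have hpowT : ∀ i ∈ T, ∀ m j, 0 < (W ^ m) i j → j ∈ T := by
    intro i hi m
    induction m with
    | zero =>
      intro j hj
      rw [pow_zero, Matrix.one_apply] at hj
      split_ifs at hj with h
      · exact h ▸ hi
      · exact absurd hj (lt_irrefl _)
    | succ m ih =>
      intro j hj
      rw [pow_succ, Matrix.mul_apply] at hj
      obtain ⟨k, -, hk⟩ := Finset.exists_ne_zero_of_sum_ne_zero hj.ne'
      exact hTc k (ih k (lt_of_le_of_ne (hpow m i k) fun h => hk (by rw [← h, zero_mul]))) j
        fun h => hk (by rw [h, mul_zero])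
  refine ⟨T, hTS, hTn, hTc, fun i hi j hj _ => ?_⟩
  have hsub : {j | ∃ m, 1 ≤ m ∧ 0 < (W ^ m) i j} ⊆ T :=
    fun j ⟨m, _, hm⟩ => hpowT i hi m j hm
  refine hmin ⟨?_, ?_⟩ hsub hj
  · obtain ⟨k, -, hk⟩ := Finset.exists_ne_zero_of_sum_ne_zero
      (show ∑ j, W i j ≠ 0 by rw [hW1]; exact one_ne_zero)
    exact ⟨k, 1, le_rfl, by rw [pow_one]; exact lt_of_le_of_ne (hW0 i k) hk.symm⟩
  · rintro k ⟨m, _, hk⟩ l hl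
    refine ⟨m + 1, by omega, ?_⟩
    rw [pow_succ, Matrix.mul_apply]
    exact (mul_pos hk (lt_of_le_of_ne (hW0 k l) hl.symm)).trans_le
      (Finset.single_le_sum (f := fun k => (W ^ m) i k * W k l)
        (fun k _ => mul_nonneg (hpow m i k) (hW0 k l)) (Finset.mem_univ k))

/-- Minimum principle: a vector `v` with `v ≥ ΞWv` is nonnegative. -/
theorem nonneg_of_mul_sum_le {n : ℕ} {W : Matrix (Fin n) (Fin n) ℝ} {ξ : Fin n → ℝ}
    (hW0 : ∀ i j, 0 ≤ W i j) (hW1 : ∀ i, ∑ j, W i j = 1)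
    (hξ : ∀ i, 0 ≤ ξ i ∧ ξ i ≤ 1) (hA2 : Assumption2 W ξ) {v : Fin n → ℝ}
    (hv : ∀ i, ξ i * ∑ j, W i j * v j ≤ v i) (i : Fin n) : 0 ≤ v i := by
  have : Nonempty (Fin n) := ⟨i⟩
  obtain ⟨a, ha⟩ := Finite.exists_min v
  refine le_trans ?_ (ha i)
  by_contra! hneg
  have hsum : ∀ k, ∑ j, W k j * (v j - v a) = ∑ j, W k j * v j - v a := by
    intro k
    simp only [mul_sub, Finset.sum_sub_distrib, ← Finset.sum_mul, hW1, one_mul]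
  have hterm : ∀ k j, 0 ≤ W k j * (v j - v a) := fun k j =>
    mul_nonneg (hW0 k j) (sub_nonneg.2 (ha j))
  have hnn : ∀ k, 0 ≤ ∑ j, W k j * (v j - v a) := fun k =>
    Finset.sum_nonneg fun j _ => hterm k j
  have hξ1 : ∀ k, v k = v a → ξ k = 1 := by
    intro k hk
    have h1 := hv k
    have h2 := hnn k
    rw [hsum] at h2
    have h3 := mul_nonneg (hξ k).1 h2
    have h4 := (hξ k).2
    by_contra hne
    nlinarith [lt_of_le_of_ne h4 hne]
  obtain ⟨T, hTS, hT⟩ := exists_isISCC_subset hW0 hW1 (S := {k | v k = v a}) ⟨a, rfl⟩ (by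
    intro k hk j hj
    have h1 := hv k
    rw [hξ1 k hk, one_mul, show v k = v a from hk] at h1
    have h0 : ∑ j, W k j * (v j - v a) = 0 := le_antisymm (by rw [hsum]; linarith) (hnn k)
    have h2 := (Finset.sum_eq_zero_iff_of_nonneg fun j _ => hterm k j).1 h0 j (Finset.mem_univ j)
    exact sub_eq_zero.1 ((mul_eq_zero.1 h2).resolve_left hj))
  obtain ⟨k, hk, hlt⟩ := hA2 T hT
  exact hlt.ne (hξ1 k (hTS hk))

theorem one_sub_diagonal_mul_mulVec {n : ℕ} (W : Matrix (Fin n) (Fin n) ℝ) (ξ v : Fin n → ℝ)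
    (i : Fin n) :
    ((1 - Matrix.diagonal ξ * W) *ᵥ v) i = v i - ξ i * ∑ j, W i j * v j := by
  rw [Matrix.sub_mulVec, Matrix.one_mulVec, ← Matrix.mulVec_mulVec, Pi.sub_apply,
    Matrix.mulVec_diagonal]
  rfl

theorem isUnit_one_sub_diagonal_mul {n : ℕ} {W : Matrix (Fin n) (Fin n) ℝ} {ξ : Fin n → ℝ}
    (hW0 : ∀ i j, 0 ≤ W i j) (hW1 : ∀ i, ∑ j, W i j = 1)
    (hξ : ∀ i, 0 ≤ ξ i ∧ ξ i ≤ 1) (hA2 : Assumption2 W ξ) :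
    IsUnit (1 - Matrix.diagonal ξ * W) := by
  rw [← Matrix.mulVec_injective_iff_isUnit]
  have hle : ∀ v w, (1 - Matrix.diagonal ξ * W) *ᵥ v = (1 - Matrix.diagonal ξ * W) *ᵥ w →
      ∀ i, 0 ≤ (v - w) i := by
    intro v w hvw i
    refine nonneg_of_mul_sum_le hW0 hW1 hξ hA2 (fun k => ?_) i
    have h := one_sub_diagonal_mul_mulVec W ξ (v - w) k
    rw [Matrix.mulVec_sub, hvw, sub_self, Pi.zero_apply] at h
    linarith
  intro v w hvw
  funext i
  have h1 := hle v w hvw i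
  have h2 := hle w v hvw.symm i
  simp only [Pi.sub_apply] at h1 h2
  linarith

/-- The matrix `Ψ = (I - ΞW)⁻¹(I - Ξ)` is row-stochastic, and its rows indexed by fully
stubborn agents are those of the identity. -/
theorem influence_rowStochastic {n : ℕ} {W Ψ : Matrix (Fin n) (Fin n) ℝ} {ξ : Fin n → ℝ}
    (hW0 : ∀ i j, 0 ≤ W i j) (hW1 : ∀ i, ∑ j, W i j = 1)
    (hξ : ∀ i, 0 ≤ ξ i ∧ ξ i ≤ 1) (hA2 : Assumption2 W ξ)
    (hΨ : Ψ = (1 - Matrix.diagonal ξ * W)⁻¹ * (1 - Matrix.diagonal ξ)) :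
    (∀ i j, 0 ≤ Ψ i j) ∧ (∀ i, ∑ j, Ψ i j = 1) ∧
      ∀ i, ξ i = 0 → ∀ v, (Ψ *ᵥ v) i = v i := by
  have hu := isUnit_one_sub_diagonal_mul hW0 hW1 hξ hA2
  have hdet := (Matrix.isUnit_iff_isUnit_det _).1 hu
  have hmul : (1 - Matrix.diagonal ξ * W) * Ψ = 1 - Matrix.diagonal ξ := by
    rw [hΨ, ← mul_assoc, Matrix.mul_nonsing_inv _ hdet, one_mul]
  have heq : ∀ v i, (Ψ *ᵥ v) i - ξ i * ∑ j, W i j * (Ψ *ᵥ v) j = v i - ξ i * v i := by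
    intro v i
    rw [← one_sub_diagonal_mul_mulVec, Matrix.mulVec_mulVec, hmul, Matrix.sub_mulVec,
      Matrix.one_mulVec, Pi.sub_apply, Matrix.mulVec_diagonal]
  refine ⟨fun i j => ?_, fun i => ?_, fun i hi v => ?_⟩
  · have h := nonneg_of_mul_sum_le hW0 hW1 hξ hA2 (v := Ψ *ᵥ Pi.single j 1) (fun k => by
      have h1 := heq (Pi.single j 1) k
      have h2 : (0 : ℝ) ≤ (Pi.single j 1 : Fin n → ℝ) k := by
        rw [Pi.single_apply]; split_ifs <;> norm_num
      nlinarith [mul_nonneg (sub_nonneg.2 (hξ k).2) h2]) i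
    rwa [Matrix.mulVec_single_one] at h
  · have h1 : Ψ *ᵥ 1 = 1 := by
      refine Matrix.mulVec_injective_iff_isUnit.2 hu ?_
      funext k
      simp only [one_sub_diagonal_mul_mulVec, heq]
      simp [hW1]
    simpa [Matrix.mulVec, dotProduct] using congrFun h1 i
  · simpa [hi] using heq v i

theorem mem_Nb {n : ℕ} {y : Fin n → ℝ} {d : ℝ} {i l : Fin n} :
    l ∈ Nb y d i ↔ |y i - y l| < d := by
  simp [Nb]

/-- One averaging step on two neighbours with `#(N_i ∩ N_j) ≥ c`. -/
theorem abs_bcStep_sub_le {n : ℕ} {y : Fin n → ℝ} {d h c : ℝ} {i j : Fin n} (hh0 : 0 ≤ h)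
    (hhn : h * n ≤ 1) (hij : |y i - y j| < d) (hc : c ≤ ((Nb y d i ∩ Nb y d j).card : ℝ)) :
    |bcStep y d h i - bcStep y d h j| ≤ d * (1 + h * (n - 2 * c)) := by
  have hd : 0 ≤ d := (abs_nonneg _).trans hij.le
  set A := Nb y d i with hA
  set B := Nb y d j with hB
  have hsA : ∑ l ∈ A, (y l - y i) =
      ∑ l ∈ A ∩ B, (y l - y i) + ∑ l ∈ A \ B, (y l - y i) :=
    (Finset.sum_inter_add_sum_sdiff A B _).symm
  have hsB : ∑ l ∈ B, (y l - y j) =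
      ∑ l ∈ A ∩ B, (y l - y j) + ∑ l ∈ B \ A, (y l - y j) := by
    rw [Finset.inter_comm A B]
    exact (Finset.sum_inter_add_sum_sdiff B A _).symm
  have hcom : ∑ l ∈ A ∩ B, (y l - y i) - ∑ l ∈ A ∩ B, (y l - y j) =
      -(((A ∩ B).card : ℝ) * (y i - y j)) := by
    rw [← Finset.sum_sub_distrib]
    simp only [sub_sub_sub_cancel_left, Finset.sum_const, nsmul_eq_mul]
    ring
  have hbA : |∑ l ∈ A \ B, (y l - y i)| ≤ ((A \ B).card : ℝ) * d := by
    refine (Finset.abs_sum_le_sum_abs _ _).trans ?_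
    rw [← nsmul_eq_mul]
    refine Finset.sum_le_card_nsmul _ _ _ fun l hl => ?_
    rw [abs_sub_comm]
    exact (mem_Nb.1 (Finset.mem_sdiff.1 hl).1).le
  have hbB : |∑ l ∈ B \ A, (y l - y j)| ≤ ((B \ A).card : ℝ) * d := by
    refine (Finset.abs_sum_le_sum_abs _ _).trans ?_
    rw [← nsmul_eq_mul]
    refine Finset.sum_le_card_nsmul _ _ _ fun l hl => ?_
    rw [abs_sub_comm]
    exact (mem_Nb.1 (Finset.mem_sdiff.1 hl).1).le
  have hcard : ((A ∩ B).card : ℝ) + (A \ B).card + (B \ A).card ≤ n := by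
    have h1 := Finset.card_inter_add_card_sdiff A B
    have h2 := Finset.card_sdiff_add_card B A
    have h3 : (B ∪ A).card ≤ n := by simpa using Finset.card_le_univ (B ∪ A)
    have h4 : (A ∩ B).card + (A \ B).card + (B \ A).card ≤ n := by omega
    exact_mod_cast h4
  have hk : h * ((A ∩ B).card : ℝ) ≤ 1 := by
    have : ((A ∩ B).card : ℝ) ≤ n := by
      exact_mod_cast (by simpa using Finset.card_le_univ (A ∩ B) : (A ∩ B).card ≤ n)
    exact (mul_le_mul_of_nonneg_left this hh0).trans hhn
  have hform : bcStep y d h i - bcStep y d h j =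
      (1 - h * (A ∩ B).card) * (y i - y j) +
        h * (∑ l ∈ A \ B, (y l - y i) - ∑ l ∈ B \ A, (y l - y j)) := by
    unfold bcStep
    rw [← hA, ← hB, hsA, hsB]
    linear_combination h * hcom
  rw [hform]
  calc _ ≤ |(1 - h * (A ∩ B).card) * (y i - y j)| +
        |h * (∑ l ∈ A \ B, (y l - y i) - ∑ l ∈ B \ A, (y l - y j))| := abs_add_le _ _
    _ ≤ (1 - h * (A ∩ B).card) * d + h * (((A \ B).card : ℝ) * d + ((B \ A).card : ℝ) * d) := by
        rw [abs_mul, abs_mul, abs_of_nonneg (sub_nonneg.2 hk), abs_of_nonneg hh0]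
        exact add_le_add (mul_le_mul_of_nonneg_left hij.le (sub_nonneg.2 hk))
          (mul_le_mul_of_nonneg_left ((abs_sub _ _).trans (add_le_add hbA hbB)) hh0)
    _ = d * (1 + h * (((A \ B).card : ℝ) + (B \ A).card - (A ∩ B).card)) := by ring
    _ ≤ d * (1 + h * (n - 2 * c)) := by
        gcongr d * (1 + h * ?_)
        linarith

theorem abs_sub_sum_mul_lt {ι : Type*} [Fintype ι] {p x : ι → ℝ} {a D : ℝ}
    (hp : ∀ l, 0 ≤ p l) (hp1 : ∑ l, p l = 1) (hx : ∀ l, 0 < p l → |a - x l| < D) :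
    |a - ∑ l, p l * x l| < D := by
  have h1 : a - ∑ l, p l * x l = ∑ l, p l * (a - x l) := by
    simp only [mul_sub, Finset.sum_sub_distrib, ← Finset.sum_mul, hp1, one_mul]
  have h2 : D = ∑ l, p l * D := by rw [← Finset.sum_mul, hp1, one_mul]
  rw [h1]
  refine (Finset.abs_sum_le_sum_abs _ _).trans_lt ?_
  rw [h2]
  obtain ⟨k, -, hk0⟩ := Finset.exists_ne_zero_of_sum_ne_zero
    (show ∑ l, p l ≠ 0 by rw [hp1]; exact one_ne_zero)
  have hk : 0 < p k := lt_of_le_of_ne (hp k) hk0.symm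
  refine Finset.sum_lt_sum (fun l _ => ?_) ⟨k, Finset.mem_univ k, ?_⟩
  · rw [abs_mul, abs_of_nonneg (hp l)]
    rcases (hp l).eq_or_lt with h | h
    · simp [← h]
    · exact mul_le_mul_of_nonneg_left (hx l h).le (hp l)
  · rw [abs_mul, abs_of_nonneg (hp k)]
    exact mul_lt_mul_of_pos_left (hx k hk) hk

/-- Lemma 5: under Assumptions 2 and 3 and `1/(2n) < h ≤ 1/n`, no edge of `G(H(0))`
is lost in `G(H(s))` for any `s`. -/
theorem no_edge_lost
    (n : ℕ) (hn : 1 ≤ n)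
    (W Ξ : Matrix (Fin n) (Fin n) ℝ) (ξ : Fin n → ℝ)
    (hW0 : ∀ i j, 0 ≤ W i j) (hW1 : ∀ i, ∑ j, W i j = 1)
    (hΞ : Ξ = Matrix.diagonal ξ) (hξ : ∀ i, 0 ≤ ξ i ∧ ξ i ≤ 1)
    (hA2 : Assumption2 W ξ)
    (Ψ : Matrix (Fin n) (Fin n) ℝ) (hΨ : Ψ = (1 - Ξ * W)⁻¹ * (1 - Ξ))
    (d h : ℝ) (hd : 0 < d)
    (hh1 : 1 / (2 * (n : ℝ)) < h) (hh2 : h ≤ 1 / (n : ℝ))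
    (x0 : Fin n → ℝ)
    -- Assumption 3(i):
    (hA3i1 : ∀ i, ξ i = 0 → ∀ j ∈ Nb (bcY Ψ h d x0 0) d i, 0 < ξ j →
      ∀ l, 0 < Ψ j l → l ∈ Nb (bcY Ψ h d x0 0) d i)
    (hA3i2 : ∀ i, 0 < ξ i → ∀ j ∈ Nb (bcY Ψ h d x0 0) d i, 0 < ξ j →
      ∀ l, 0 < Ψ j l →
        l ∈ Nb (bcY Ψ h d x0 0) d j ∧ l ∈ Nb (bcY Ψ h d x0 0) d i)
    -- Assumption 3(ii):
    (hA3ii1 : ∀ i j, ξ i = 0 → ξ j = 0 → j ∈ Nb (bcY Ψ h d x0 0) d i →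
      (n : ℝ) / 2 < ((Nb (bcY Ψ h d x0 0) d i ∩ Nb (bcY Ψ h d x0 0) d j).card : ℝ))
    (hA3ii2 : ∀ i j, 0 < ξ i → j ∈ Nb (bcY Ψ h d x0 0) d i →
      (n : ℝ) / 2 + 1 / (4 * h) <
        ((Nb (bcY Ψ h d x0 0) d i ∩ Nb (bcY Ψ h d x0 0) d j).card : ℝ)) :
    ∀ s : ℕ, ∀ i j, |bcY Ψ h d x0 0 i - bcY Ψ h d x0 0 j| < d →
      |bcY Ψ h d x0 s i - bcY Ψ h d x0 s j| < d := by
  subst hΞ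
  obtain ⟨hΨ0, hΨ1, hΨs⟩ := influence_rowStochastic hW0 hW1 hξ hA2 hΨ
  have hn0 : (0 : ℝ) < n := by exact_mod_cast hn
  have hh0 : 0 < h := lt_trans (by positivity) hh1
  have hhn : h * n ≤ 1 := (le_div_iff₀ hn0).1 hh2
  have hsymm : ∀ {i j : Fin n}, j ∈ Nb (bcY Ψ h d x0 0) d i → i ∈ Nb (bcY Ψ h d x0 0) d j := by
    intro i j hj
    rw [mem_Nb] at hj ⊢
    rwa [abs_sub_comm]
  have hself : ∀ i, i ∈ Nb (bcY Ψ h d x0 0) d i := fun i => mem_Nb.2 (by simpa using hd)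
  suffices H : ∀ s i j, j ∈ Nb (bcY Ψ h d x0 0) d i → j ∈ Nb (bcY Ψ h d x0 s) d i from
    fun s i j hij => mem_Nb.1 (H s i j (mem_Nb.2 hij))
  intro s
  induction s with
  | zero => exact fun i j hij => hij
  | succ s ih =>
    have hxle : ∀ i j, j ∈ Nb (bcY Ψ h d x0 0) d i →
        |bcX Ψ h d x0 (s + 1) i - bcX Ψ h d x0 (s + 1) j| ≤ d * (1 + h * (n - 2 *
          ((Nb (bcY Ψ h d x0 0) d i ∩ Nb (bcY Ψ h d x0 0) d j).card : ℝ))) :=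
      fun i j hij => abs_bcStep_sub_le (y := bcY Ψ h d x0 s) hh0.le hhn (mem_Nb.1 (ih i j hij))
        (by exact_mod_cast Finset.card_le_card (Finset.inter_subset_inter (ih i) (ih j)))
    have hhalf : ∀ i j, 0 < ξ i → j ∈ Nb (bcY Ψ h d x0 0) d i →
        |bcX Ψ h d x0 (s + 1) i - bcX Ψ h d x0 (s + 1) j| < d / 2 := by
      intro i j hi hij
      have hc := mul_lt_mul_of_pos_left (hA3ii2 i j hi hij) hh0
      have h4 : h * (1 / (4 * h)) = 1 / 4 := by field_simp
      rw [mul_add, h4] at hc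
      refine (hxle i j hij).trans_lt ?_
      rw [div_eq_mul_inv]
      exact mul_lt_mul_of_pos_left (by linarith) hd
    have hfull : ∀ i j, j ∈ Nb (bcY Ψ h d x0 0) d i →
        |bcX Ψ h d x0 (s + 1) i - bcX Ψ h d x0 (s + 1) j| < d := by
      intro i j hij
      rcases (hξ i).1.eq_or_lt with hi | hi
      · rcases (hξ j).1.eq_or_lt with hj | hj
        · have hc := mul_lt_mul_of_pos_left (hA3ii1 i j hi.symm hj.symm hij) hh0
          refine (hxle i j hij).trans_lt ?_
          conv_rhs => rw [← mul_one d]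
          exact mul_lt_mul_of_pos_left (by linarith) hd
        · rw [abs_sub_comm]
          exact (hhalf j i hj (hsymm hij)).trans (half_lt_self hd)
      · exact (hhalf i j hi hij).trans (half_lt_self hd)
    have hmixed : ∀ i j, ξ i = 0 → 0 < ξ j → j ∈ Nb (bcY Ψ h d x0 0) d i →
        |bcY Ψ h d x0 (s + 1) i - bcY Ψ h d x0 (s + 1) j| < d := by
      intro i j hi hj hij
      have hyi : bcY Ψ h d x0 (s + 1) i = bcX Ψ h d x0 (s + 1) i := hΨs i hi _
      rw [hyi]
      exact abs_sub_sum_mul_lt (hΨ0 j) (hΨ1 j) fun l hl => hfull i l (hA3i1 i hi j hij hj l hl)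
    intro i j hij
    rw [mem_Nb]
    rcases (hξ i).1.eq_or_lt with hi | hi <;> rcases (hξ j).1.eq_or_lt with hj | hj
    · have hyi : bcY Ψ h d x0 (s + 1) i = bcX Ψ h d x0 (s + 1) i := hΨs i hi.symm _
      have hyj : bcY Ψ h d x0 (s + 1) j = bcX Ψ h d x0 (s + 1) j := hΨs j hj.symm _
      rw [hyi, hyj]
      exact hfull i j hij
    · exact hmixed i j hi.symm hj hij
    · rw [abs_sub_comm]
      exact hmixed j i hj.symm hi (hsymm hij)
    · have h1 : |bcX Ψ h d x0 (s + 1) i - bcY Ψ h d x0 (s + 1) i| < d / 2 :=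
        abs_sub_sum_mul_lt (hΨ0 i) (hΨ1 i) fun l hl =>
          hhalf i l hi (hA3i2 i hi i (hself i) hi l hl).2
      have h2 : |bcX Ψ h d x0 (s + 1) i - bcY Ψ h d x0 (s + 1) j| < d / 2 :=
        abs_sub_sum_mul_lt (hΨ0 j) (hΨ1 j) fun l hl =>
          hhalf i l hi (hA3i2 i hi j hij hj l hl).2
      rw [abs_sub_comm] at h1
      linarith [abs_sub_le (bcY Ψ h d x0 (s + 1) i) (bcX Ψ h d x0 (s + 1) i)
        (bcY Ψ h d x0 (s + 1) j)]
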